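/- In a radial embedding of an ordered graph on the cylinder, there are exactly two outer faces if and only if the graph contains an essential cycle. -/

import Mathlib

open Set

noncomputable section

instance : Fact ((0:ℝ) < 1) := ⟨one_pos⟩

/-- The cylinder `𝒞 = I × S¹`: we use `ℝ × ℝ/ℤ` and restrict the first
coordinate to `[0,1]` where needed.  `I(x)` is the first projection. -/
abbrev Cyl : Type := ℝ × AddCircle (1 : ℝ)

/-- The points of the cylinder whose `I`-coordinate lies in `[0,1]`. -/
def cylSet : Set Cyl := {x : Cyl | x.1 ∈ Icc (0:ℝ) 1}

/-- The common interior points of two curves (parameter in the open interval). -/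
def interPts {X : Type} (γ δ : unitInterval → X) : Set X :=
  (γ '' {t : unitInterval | 0 < (t:ℝ) ∧ (t:ℝ) < 1}) ∩
    (δ '' {t : unitInterval | 0 < (t:ℝ) ∧ (t:ℝ) < 1})

/-- The clockwise angular distance from `c` to `p` on the circle, as a number in `[0,1)`. -/
def angleFrom (c p : AddCircle (1:ℝ)) : ℝ := (AddCircle.equivIco 1 0 (c - p)).1

/-- An ordered (multi)graph on a linearly ordered vertex type.  Each edge is
recorded with its smaller endpoint `src` and larger endpoint `dst`; in
particular there are no loops. -/
structure OrderedGraph (V : Type) [LinearOrder V] where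
  E : Type
  finE : Finite E
  src : E → V
  dst : E → V
  src_lt_dst : ∀ e, src e < dst e

variable {V : Type} [LinearOrder V]

/-- A dart: an edge together with a direction of traversal
(`flip = false` means from `src` to `dst`). -/
structure Dart (G : OrderedGraph V) where
  e : G.E
  flip : Bool

def Dart.fst {G : OrderedGraph V} (d : Dart G) : V :=
  if d.flip then G.dst d.e else G.src d.e

def Dart.snd {G : OrderedGraph V} (d : Dart G) : V :=
  if d.flip then G.src d.e else G.dst d.e

/-- A (nonempty) walk in a multigraph: a sequence of compatible darts. -/
structure Walk (G : OrderedGraph V) where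
  n : ℕ
  npos : 0 < n
  d : Fin n → Dart G
  chain : ∀ i : ℕ, ∀ h : i + 1 < n, (d ⟨i, by omega⟩).snd = (d ⟨i + 1, h⟩).fst

namespace Walk

variable {G : OrderedGraph V}

/-- The `i`-th vertex of a walk, `0 ≤ i ≤ n`. -/
def vtx (w : Walk G) (i : ℕ) : V :=
  if h : i < w.n then (w.d ⟨i, h⟩).fst
  else (w.d ⟨w.n - 1, Nat.sub_lt w.npos Nat.one_pos⟩).snd

def first (w : Walk G) : V := w.vtx 0
def last (w : Walk G) : V := w.vtx w.n
def verts (w : Walk G) : Set V := w.vtx '' Set.Iic w.n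
def edges (w : Walk G) : Set G.E := Set.range fun i => (w.d i).e
def IsClosed (w : Walk G) : Prop := w.last = w.first
def IsPath (w : Walk G) : Prop := Set.InjOn w.vtx (Set.Iic w.n)

/-- A cycle: a closed walk of length at least two with pairwise distinct
edges and pairwise distinct vertices. -/
def IsCycle (w : Walk G) : Prop :=
  w.IsClosed ∧ 2 ≤ w.n ∧ Function.Injective (fun i : Fin w.n => (w.d i).e) ∧
    Set.InjOn w.vtx (Set.Iio w.n)

end Walk

/-- Connectivity of a multigraph. -/
def OrderedGraph.Connected (G : OrderedGraph V) : Prop :=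
  ∀ u v : V, u = v ∨ ∃ w : Walk G, w.first = u ∧ w.last = v

/-- Two edges are independent if they share no endpoint. -/
def OrderedGraph.Independent (G : OrderedGraph V) (e f : G.E) : Prop :=
  G.src e ≠ G.src f ∧ G.src e ≠ G.dst f ∧ G.dst e ≠ G.src f ∧ G.dst e ≠ G.dst f

/-- `B` is a connected component of `G` minus the vertex set `A`. -/
def IsCompOf (G : OrderedGraph V) (A B : Set V) : Prop :=
  B.Nonempty ∧ (∀ b ∈ B, b ∉ A) ∧
  (∀ x ∈ B, ∀ y ∈ B, x = y ∨
      ∃ w : Walk G, w.first = x ∧ w.last = y ∧ ∀ i ≤ w.n, w.vtx i ∈ B) ∧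
  (∀ e : G.E, (G.src e ∈ B → G.dst e ∉ A → G.dst e ∈ B) ∧
      (G.dst e ∈ B → G.src e ∉ A → G.src e ∈ B))

/-- A drawing of an ordered graph on the cylinder: vertices are placed at
distinct points respecting the vertex order in the `I`-coordinate; each
edge is drawn as a simple curve from the drawing of its smaller endpoint to
the drawing of its larger endpoint; no edge passes through a vertex, and two
distinct edges meet, apart from common endpoints, in a finite set of
crossing points. -/
structure CylDrawing (G : OrderedGraph V) where
  pos : V → Cyl
  posI : ∀ v, (pos v).1 ∈ Icc (0:ℝ) 1
  posOrd : ∀ u v : V, u < v → (pos u).1 < (pos v).1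
  ed : G.E → unitInterval → Cyl
  edCont : ∀ e, Continuous (ed e)
  edSimple : ∀ e, Function.Injective (ed e)
  edI : ∀ e (t : unitInterval), (ed e t).1 ∈ Icc (0:ℝ) 1
  ed0 : ∀ e, ed e 0 = pos (G.src e)
  ed1 : ∀ e, ed e 1 = pos (G.dst e)
  noVertexHit : ∀ e v (t : unitInterval), 0 < (t:ℝ) → (t:ℝ) < 1 → ed e t ≠ pos v
  crossFin : ∀ e f : G.E, e ≠ f → (interPts (ed e) (ed f)).Finite

namespace CylDrawing

variable {G : OrderedGraph V}

/-- A drawing is radial if the projection of every edge to `I` is injective. -/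
def IsRadial (D : CylDrawing G) : Prop :=
  ∀ e, Function.Injective fun t : unitInterval => (D.ed e t).1

/-- An edge is bounded if its interior points lie strictly between its
endpoints in the `I`-coordinate; a drawing is bounded if all edges are. -/
def IsBounded (D : CylDrawing G) : Prop :=
  ∀ e (t : unitInterval), 0 < (t:ℝ) → (t:ℝ) < 1 →
    (D.pos (G.src e)).1 < (D.ed e t).1 ∧ (D.ed e t).1 < (D.pos (G.dst e)).1

/-- The crossing points of two edges. -/
def crossSet (D : CylDrawing G) (e f : G.E) : Set Cyl := interPts (D.ed e) (D.ed f)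

/-- Two edges cross an even number of times. -/
def CrossEven (D : CylDrawing G) (e f : G.E) : Prop := Even (D.crossSet e f).ncard

/-- Every two edges cross an even number of times. -/
def EvenDrawing (D : CylDrawing G) : Prop := ∀ e f, e ≠ f → D.CrossEven e f

/-- Every two independent edges cross an even number of times. -/
def IndepEven (D : CylDrawing G) : Prop := ∀ e f, G.Independent e f → D.CrossEven e f

/-- A crossing-free drawing. -/
def IsEmbedding (D : CylDrawing G) : Prop := ∀ e f, e ≠ f → D.crossSet e f = ∅

/-- The drawn edge as a map on `ℝ` (clamped to `[0,1]`). -/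
def edR (D : CylDrawing G) (e : G.E) (t : ℝ) : Cyl := D.ed e (projIcc 0 1 zero_le_one t)

/-- The drawn dart (edge traversed according to the orientation). -/
def dartMap (D : CylDrawing G) (d : Dart G) (t : ℝ) : Cyl :=
  if d.flip then D.edR d.e (1 - t) else D.edR d.e t

/-- The curve of a walk, parametrized on `[0,1]` by concatenating the darts. -/
def walkMap (D : CylDrawing G) (w : Walk G) (t : ℝ) : Cyl :=
  D.dartMap
    (w.d ⟨min ⌊t * (w.n : ℝ)⌋₊ (w.n - 1),
          lt_of_le_of_lt (min_le_right _ _) (Nat.sub_lt w.npos Nat.one_pos)⟩)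
    (t * (w.n : ℝ) - (min ⌊t * (w.n : ℝ)⌋₊ (w.n - 1) : ℕ))

/-- A closed walk is essential in a drawing if its winding number is odd,
i.e. any continuous lift of the `S¹`-coordinate of its curve to `ℝ`
changes by an odd integer. -/
def EssentialIn (D : CylDrawing G) (w : Walk G) : Prop :=
  ∃ g : ℝ → ℝ, ContinuousOn g (Icc 0 1) ∧
    (∀ t ∈ Icc (0:ℝ) 1, ((g t : ℝ) : AddCircle (1:ℝ)) = (D.walkMap w t).2) ∧
    ∃ k : ℤ, Odd k ∧ g 1 - g 0 = (k : ℝ)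

/-- `D₂` is supported by `D₁`: for every cycle essential in `D₂` there is a
cycle essential in `D₁` with `[min C₁, max C₁] ⊆ [min C₂, max C₂]`. -/
def SupportedBy (D₂ D₁ : CylDrawing G) : Prop :=
  ∀ C₂ : Walk G, C₂.IsCycle → D₂.EssentialIn C₂ →
    ∃ C₁ : Walk G, C₁.IsCycle ∧ D₁.EssentialIn C₁ ∧
      ∀ x ∈ C₁.verts, (∃ u ∈ C₂.verts, u ≤ x) ∧ (∃ u ∈ C₂.verts, x ≤ u)

/-- Every essential cycle passes through the first or the last vertex. -/
def WeaklyEssential (D : CylDrawing G) : Prop :=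
  ∀ C : Walk G, C.IsCycle → D.EssentialIn C →
    ∃ x ∈ C.verts, (∀ u : V, x ≤ u) ∨ (∀ u : V, u ≤ x)

/-- `e` comes before `f` in the upper rotation at `v`: both are upper edges
at `v`, and for all sufficiently small `ε > 0` the point of `e` on the circle
at height `I(v) + ε` precedes that of `f` read clockwise from the
circular position of `v`. -/
def UpperBefore (D : CylDrawing G) (v : V) (e f : G.E) : Prop :=
  G.src e = v ∧ G.src f = v ∧
  ∃ ε₀ > (0:ℝ), ∀ ε : ℝ, 0 < ε → ε < ε₀ →
    ∀ s t : unitInterval,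
      (D.ed e s).1 = (D.pos v).1 + ε → (D.ed f t).1 = (D.pos v).1 + ε →
        angleFrom (D.pos v).2 (D.ed e s).2 < angleFrom (D.pos v).2 (D.ed f t).2

/-- `e` comes before `f` in the lower rotation at `v`. -/
def LowerBefore (D : CylDrawing G) (v : V) (e f : G.E) : Prop :=
  G.dst e = v ∧ G.dst f = v ∧
  ∃ ε₀ > (0:ℝ), ∀ ε : ℝ, 0 < ε → ε < ε₀ →
    ∀ s t : unitInterval,
      (D.ed e s).1 = (D.pos v).1 - ε → (D.ed f t).1 = (D.pos v).1 - ε →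
        angleFrom (D.pos v).2 (D.ed e s).2 < angleFrom (D.pos v).2 (D.ed f t).2

/-- Two drawings of the same graph have the same rotation system. -/
def SameRotation (D₁ D₂ : CylDrawing G) : Prop :=
  (∀ v e f, D₁.UpperBefore v e f ↔ D₂.UpperBefore v e f) ∧
  (∀ v e f, D₁.LowerBefore v e f ↔ D₂.LowerBefore v e f)

/-- The projection `I(W)` to `[0,1]` of the drawing of (the edges of) a walk. -/
def iSet (D : CylDrawing G) (w : Walk G) : Set ℝ :=
  ⋃ i : Fin w.n, Set.range fun t : unitInterval => (D.ed (w.d i).e t).1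

/-- The image of the drawn graph on the cylinder. -/
def image (D : CylDrawing G) : Set Cyl :=
  (⋃ e, Set.range (D.ed e)) ∪ Set.range D.pos

/-- A face: a connected component of the complement of the drawing in the cylinder. -/
def IsFace (D : CylDrawing G) (F : Set Cyl) : Prop :=
  ∃ p ∈ cylSet \ D.image, F = connectedComponentIn (cylSet \ D.image) p

/-- An outer face: a face whose closure meets one of the two boundary circles. -/
def IsOuterFace (D : CylDrawing G) (F : Set Cyl) : Prop :=
  D.IsFace F ∧ ∃ x ∈ closure F, x.1 = (0:ℝ) ∨ x.1 = 1

/-- The vertices lying on the boundary of a face (the vertices of its facial walk). -/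
def bdVerts (D : CylDrawing G) (F : Set Cyl) : Set V := {v | D.pos v ∈ frontier F}

/-- The parity of the number of crossings of two edges, in `ℤ/2ℤ`. -/
def crPar (D : CylDrawing G) (e f : G.E) : ZMod 2 := ((D.crossSet e f).ncard : ZMod 2)

end CylDrawing

/-- `G` has a radial embedding (with its given vertex order). -/
def HasRadialEmbedding (G : OrderedGraph V) : Prop :=
  ∃ D : CylDrawing G, D.IsRadial ∧ D.IsEmbedding

/-- A drawing of an ordered graph in the plane. -/
structure PlaneDrawing (G : OrderedGraph V) where
  pos : V → ℝ × ℝ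
  posOrd : ∀ u v : V, u < v → (pos u).1 < (pos v).1
  ed : G.E → unitInterval → ℝ × ℝ
  edCont : ∀ e, Continuous (ed e)
  edSimple : ∀ e, Function.Injective (ed e)
  ed0 : ∀ e, ed e 0 = pos (G.src e)
  ed1 : ∀ e, ed e 1 = pos (G.dst e)
  noVertexHit : ∀ e v (t : unitInterval), 0 < (t:ℝ) → (t:ℝ) < 1 → ed e t ≠ pos v
  crossFin : ∀ e f : G.E, e ≠ f → (interPts (ed e) (ed f)).Finite

namespace PlaneDrawing

variable {G : OrderedGraph V}

/-- Every edge meets every vertical line at most once. -/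
def IsXMonotone (D : PlaneDrawing G) : Prop :=
  ∀ e, Function.Injective fun t : unitInterval => (D.ed e t).1

def IsEmbedding (D : PlaneDrawing G) : Prop :=
  ∀ e f, e ≠ f → interPts (D.ed e) (D.ed f) = ∅

end PlaneDrawing

/-- `G` has an `x`-monotone embedding. -/
def HasXMonotoneEmbedding (G : OrderedGraph V) : Prop :=
  ∃ D : PlaneDrawing G, D.IsXMonotone ∧ D.IsEmbedding

/-- `G` satisfies the strong Hanani–Tutte theorem for radial drawings:
for every independently even radial drawing `D'` of `G`, `G` has a radial
embedding supported by `D'`, and it has an `x`-monotone embedding whenever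
`D'` is weakly essential. -/
def Satisfies (G : OrderedGraph V) : Prop :=
  ∀ D' : CylDrawing G, D'.IsRadial → D'.IndepEven →
    (∃ E : CylDrawing G, E.IsRadial ∧ E.IsEmbedding ∧ E.SupportedBy D') ∧
    (D'.WeaklyEssential → HasXMonotoneEmbedding G)

/-- Every ordered graph with fewer vertices, or with the same number of
vertices and fewer edges, satisfies the theorem. -/
def MinimalityBelow (G : OrderedGraph V) : Prop :=
  ∀ (V' : Type) [LinearOrder V'] [Finite V'] (G' : OrderedGraph V'),
    (Nat.card V' < Nat.card V ∨
      (Nat.card V' = Nat.card V ∧ Nat.card G'.E < Nat.card G.E)) →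
    Satisfies G'

/-- `(G, D)` is a minimal counterexample to the strong Hanani–Tutte theorem
for radial drawings. -/
def IsMinimalCex (G : OrderedGraph V) (D : CylDrawing G) : Prop :=
  D.IsRadial ∧ D.IndepEven ∧
  ¬ ((∃ E : CylDrawing G, E.IsRadial ∧ E.IsEmbedding ∧ E.SupportedBy D) ∧
      (D.WeaklyEssential → HasXMonotoneEmbedding G)) ∧
  MinimalityBelow G

/-- The graph obtained from `G` by adding one extra edge from `a` to `b`. -/
def OrderedGraph.addEdge (G : OrderedGraph V) (a b : V) (h : a < b) : OrderedGraph V where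
  E := Option G.E
  finE := by haveI := G.finE; exact Finite.of_equiv _ (Equiv.optionEquivSumPUnit.{0,0} G.E).symm
  src e := match e with | none => a | some e => G.src e
  dst e := match e with | none => b | some e => G.dst e
  src_lt_dst e := match e with | none => h | some e => G.src_lt_dst e

/-- Forgetting the added edge of a drawing of `G.addEdge a b h`. -/
def CylDrawing.restrictAdd {G : OrderedGraph V} {a b : V} {h : a < b}
    (D : CylDrawing (G.addEdge a b h)) : CylDrawing G where
  pos := D.pos
  posI := D.posI
  posOrd := D.posOrd
  ed e := D.ed (some e)
  edCont e := D.edCont (some e)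
  edSimple e := D.edSimple (some e)
  edI e := D.edI (some e)
  ed0 e := D.ed0 (some e)
  ed1 e := D.ed1 (some e)
  noVertexHit e := D.noVertexHit (some e)
  crossFin e f hef := D.crossFin (some e) (some f) (fun hs => hef (Option.some.inj hs))

/-- A leveled (multi)graph: every vertex is assigned a level. -/
structure LeveledGraph (V : Type) where
  E : Type
  finE : Finite E
  src : E → V
  dst : E → V
  noLoop : ∀ e, src e ≠ dst e
  level : V → ℕ

/-- A radial drawing of a leveled graph: the vertices of level `j` lie on the
circle at height `c j`, where `c` is strictly increasing; edges are simple
radial curves; no edge passes through a vertex; two distinct edges meet, apart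
from common endpoints, in a finite set of crossing points. -/
structure LRadialDrawing {V : Type} (G : LeveledGraph V) where
  c : ℕ → ℝ
  cMono : StrictMono c
  cI : ∀ j, c j ∈ Icc (0:ℝ) 1
  pos : V → Cyl
  posInj : Function.Injective pos
  posLevel : ∀ v, (pos v).1 = c (G.level v)
  ed : G.E → unitInterval → Cyl
  edCont : ∀ e, Continuous (ed e)
  edSimple : ∀ e, Function.Injective (ed e)
  edI : ∀ e (t : unitInterval), (ed e t).1 ∈ Icc (0:ℝ) 1
  radial : ∀ e, Function.Injective fun t : unitInterval => (ed e t).1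
  ed0 : ∀ e, ed e 0 = pos (G.src e)
  ed1 : ∀ e, ed e 1 = pos (G.dst e)
  noVertexHit : ∀ e v (t : unitInterval), 0 < (t:ℝ) → (t:ℝ) < 1 → ed e t ≠ pos v
  crossFin : ∀ e f : G.E, e ≠ f → (interPts (ed e) (ed f)).Finite

namespace LRadialDrawing

variable {G : LeveledGraph V}

def CrossEven (D : LRadialDrawing G) (e f : G.E) : Prop :=
  Even (interPts (D.ed e) (D.ed f)).ncard

def EvenDrawing (D : LRadialDrawing G) : Prop := ∀ e f, e ≠ f → D.CrossEven e f

/-- Two edges are independent if they share no endpoint. -/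
def Independent (G : LeveledGraph V) (e f : G.E) : Prop :=
  G.src e ≠ G.src f ∧ G.src e ≠ G.dst f ∧ G.dst e ≠ G.src f ∧ G.dst e ≠ G.dst f

def IndepEven (D : LRadialDrawing G) : Prop :=
  ∀ e f, Independent G e f → D.CrossEven e f

def IsEmbedding (D : LRadialDrawing G) : Prop :=
  ∀ e f, e ≠ f → interPts (D.ed e) (D.ed f) = ∅

/-- `e` is an upper edge at its endpoint `v` (the other endpoint is drawn higher). -/
def IsUpperAt (D : LRadialDrawing G) (v : V) (e : G.E) : Prop :=
  (G.src e = v ∧ (D.pos v).1 < (D.pos (G.dst e)).1) ∨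
  (G.dst e = v ∧ (D.pos v).1 < (D.pos (G.src e)).1)

def IsLowerAt (D : LRadialDrawing G) (v : V) (e : G.E) : Prop :=
  (G.src e = v ∧ (D.pos (G.dst e)).1 < (D.pos v).1) ∨
  (G.dst e = v ∧ (D.pos (G.src e)).1 < (D.pos v).1)

def UpperBefore (D : LRadialDrawing G) (v : V) (e f : G.E) : Prop :=
  D.IsUpperAt v e ∧ D.IsUpperAt v f ∧
  ∃ ε₀ > (0:ℝ), ∀ ε : ℝ, 0 < ε → ε < ε₀ →
    ∀ s t : unitInterval,
      (D.ed e s).1 = (D.pos v).1 + ε → (D.ed f t).1 = (D.pos v).1 + ε →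
        angleFrom (D.pos v).2 (D.ed e s).2 < angleFrom (D.pos v).2 (D.ed f t).2

def LowerBefore (D : LRadialDrawing G) (v : V) (e f : G.E) : Prop :=
  D.IsLowerAt v e ∧ D.IsLowerAt v f ∧
  ∃ ε₀ > (0:ℝ), ∀ ε : ℝ, 0 < ε → ε < ε₀ →
    ∀ s t : unitInterval,
      (D.ed e s).1 = (D.pos v).1 - ε → (D.ed f t).1 = (D.pos v).1 - ε →
        angleFrom (D.pos v).2 (D.ed e s).2 < angleFrom (D.pos v).2 (D.ed f t).2

def SameRotation (D₁ D₂ : LRadialDrawing G) : Prop :=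
  (∀ v e f, D₁.UpperBefore v e f ↔ D₂.UpperBefore v e f) ∧
  (∀ v e f, D₁.LowerBefore v e f ↔ D₂.LowerBefore v e f)

end LRadialDrawing

/-- The transport along a pair of points of a grid: the jump of `s` if one of the points is in the
set `b`, and zero otherwise. -/
def gridTransport (b : ℕ → ℕ → Prop) (s : ℕ → ℕ → ZMod 2) (i j k l : ℕ) : ZMod 2 :=
  open Classical in if b i j ∨ b k l then s i j + s k l else 0

lemma gridTransport_square {b : ℕ → ℕ → Prop} {s : ℕ → ℕ → ZMod 2} {i j : ℕ}
    (h : (b i j ∧ b i (j + 1) ∧ b (i + 1) j ∧ b (i + 1) (j + 1)) ∨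
      (¬ b i j ∧ ¬ b i (j + 1) ∧ ¬ b (i + 1) j ∧ ¬ b (i + 1) (j + 1)) ∨
      (s i j = s i (j + 1) ∧ s i j = s (i + 1) j ∧ s i j = s (i + 1) (j + 1))) :
    gridTransport b s i j i (j + 1) + gridTransport b s (i + 1) j (i + 1) (j + 1) =
      gridTransport b s i j (i + 1) j + gridTransport b s i (j + 1) (i + 1) (j + 1) := by
  unfold gridTransport
  rcases h with ⟨h1, h2, h3, h4⟩ | ⟨h1, h2, h3, h4⟩ | ⟨h1, h2, h3⟩
  · simp only [h1, h2, h3, h4, or_self, if_true]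
    ring
  · simp only [h1, h2, h3, h4, or_self, if_false]
  · simp only [← h1, ← h2, ← h3, CharTwo.add_self_eq_zero, ite_self]

/-- A combinatorial obstruction: a periodic region containing the first row of a grid and disjoint
from the last row cannot be bounded by places where an antiperiodic function is constant. -/
lemma grid_obstruction (N : ℕ) (b : ℕ → ℕ → Prop) (s : ℕ → ℕ → ZMod 2)
    (hb : ∀ i ≤ N, (b i N ↔ b i 0)) (hs : ∀ i ≤ N, s i N = s i 0 + 1)
    (h : ∀ i < N, ∀ j < N, (b i j ∧ b i (j + 1) ∧ b (i + 1) j ∧ b (i + 1) (j + 1)) ∨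
      (¬ b i j ∧ ¬ b i (j + 1) ∧ ¬ b (i + 1) j ∧ ¬ b (i + 1) (j + 1)) ∨
      (s i j = s i (j + 1) ∧ s i j = s (i + 1) j ∧ s i j = s (i + 1) (j + 1)))
    (h0 : ∀ j ≤ N, b 0 j) (hN : ∀ j ≤ N, ¬ b N j) : False := by
  set R : ℕ → ZMod 2 := fun i => ∑ j ∈ Finset.range N, gridTransport b s i j i (j + 1) with hR
  have tele : ∀ f : ℕ → ZMod 2, ∀ n : ℕ, ∑ j ∈ Finset.range n, (f j + f (j + 1)) = f 0 + f n := by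
    intro f n
    induction n with
    | zero => simp [CharTwo.add_self_eq_zero]
    | succ n ih =>
      rw [Finset.sum_range_succ, ih]
      have := CharTwo.add_self_eq_zero (f n)
      linear_combination this
  have step : ∀ i < N, R i = R (i + 1) := by
    intro i hi
    have h1 : R i + R (i + 1) = 0 := by
      rw [hR]
      simp only
      rw [← Finset.sum_add_distrib, Finset.sum_congr rfl fun j hj =>
        gridTransport_square (h i hi j (Finset.mem_range.1 hj)),
        tele (fun j => gridTransport b s i j (i + 1) j)]
      have hiff : (b i N ∨ b (i + 1) N) ↔ (b i 0 ∨ b (i + 1) 0) := by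
        rw [hb i hi.le, hb (i + 1) hi]
      simp only [gridTransport, hs i hi.le, hs (i + 1) hi]
      by_cases hc : b i 0 ∨ b (i + 1) 0
      · simp only [hc, hiff.2 hc, if_true]
        have h2 := CharTwo.add_self_eq_zero (s i 0)
        have h3 := CharTwo.add_self_eq_zero (s (i + 1) 0)
        have h4 := CharTwo.add_self_eq_zero (1 : ZMod 2)
        linear_combination h2 + h3 + h4
      · simp only [hc, mt hiff.1 hc, if_false, add_zero]
    exact CharTwo.add_eq_zero.1 h1
  have const : ∀ i ≤ N, R 0 = R i := by
    intro i
    induction i with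
    | zero => intro _; rfl
    | succ i ih => intro hi; rw [ih (by omega), step i (by omega)]
  have hR0 : R 0 = 1 := by
    have : R 0 = ∑ j ∈ Finset.range N, (s 0 j + s 0 (j + 1)) :=
      Finset.sum_congr rfl fun j hj => by
        simp [gridTransport, h0 j (Finset.mem_range.1 hj).le]
    rw [this, tele, hs 0 (Nat.zero_le _), ← add_assoc, CharTwo.add_self_eq_zero, zero_add]
  have hRN : R N = 0 := Finset.sum_eq_zero fun j hj => by
    have := Finset.mem_range.1 hj
    simp [gridTransport, hN j this.le, hN (j + 1) this]
  rw [const N le_rfl, hRN] at hR0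
  exact zero_ne_one hR0

/-- The half turn of the double cover of the cylinder. -/
def halfTurn (p : ℝ × AddCircle (2 : ℝ)) : ℝ × AddCircle (2 : ℝ) := (p.1, p.2 + ((1 : ℝ) : AddCircle (2:ℝ)))

lemma halfTurn_halfTurn (p : ℝ × AddCircle (2 : ℝ)) : halfTurn (halfTurn p) = p := by
  have : ((1 : ℝ) : AddCircle (2:ℝ)) + ((1 : ℝ) : AddCircle (2:ℝ)) = 0 := by
    rw [← AddCircle.coe_add, one_add_one_eq_two, AddCircle.coe_period]
  simp [halfTurn, add_assoc, this]

lemma dist_halfTurn (p q : ℝ × AddCircle (2 : ℝ)) : dist (halfTurn p) (halfTurn q) = dist p q := by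
  simp [halfTurn, Prod.dist_eq]

/-- The covering of the double cover of the cylinder by the plane. -/
def planeCover (p : ℝ × ℝ) : ℝ × AddCircle (2 : ℝ) := (p.1, (p.2 : AddCircle (2:ℝ)))

lemma dist_planeCover_le (p q : ℝ × ℝ) : dist (planeCover p) (planeCover q) ≤ dist p q := by
  simp only [planeCover, Prod.dist_eq]
  refine max_le_max le_rfl ?_
  rw [dist_eq_norm, dist_eq_norm, ← AddCircle.coe_sub]
  exact QuotientAddGroup.norm_mk_le_norm

lemma planeCover_add_one (x y : ℝ) : planeCover (x, y + 1) = halfTurn (planeCover (x, y)) := by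
  simp [planeCover, halfTurn]

/-- If a compact set in the double cover of the cylinder is disjoint from its half turn, then their
union does not separate the two ends of the cylinder. -/
lemma not_separating_of_disjoint_halfTurn (K : Set (ℝ × AddCircle (2 : ℝ))) (hK : IsCompact K)
    (hdisj : ∀ k ∈ K, halfTurn k ∉ K) (B : Set (ℝ × ℝ))
    (hB : ∀ x y, (x, y + 1) ∈ B ↔ (x, y) ∈ B)
    (h0 : ∀ y, ((0 : ℝ), y) ∈ B) (h1 : ∀ y, ((1 : ℝ), y) ∉ B)
    (hsep : ∀ p q : ℝ × ℝ, p.1 ∈ Icc (0:ℝ) 1 → q.1 ∈ Icc (0:ℝ) 1 → p ∈ B → q ∉ B →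
      ∃ r ∈ segment ℝ p q, planeCover r ∈ K ∨ halfTurn (planeCover r) ∈ K) : False := by
  classical
  have hcont : Continuous halfTurn := by unfold halfTurn; fun_prop
  have hK' : IsCompact (halfTurn '' K) := hK.image hcont
  have hd : Disjoint K (halfTurn '' K) := by
    rw [Set.disjoint_left]
    rintro _ hk ⟨k, hk', rfl⟩
    exact hdisj k hk' hk
  obtain ⟨δ, hδ, hthick⟩ := hd.exists_thickenings hK hK'.isClosed
  set S : ℝ × ℝ → ZMod 2 := fun p =>
    if planeCover p ∈ Metric.thickening δ K then 0
    else if planeCover p ∈ Metric.thickening δ (halfTurn '' K) then 1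
    else ((⌊p.2⌋ : ℤ) : ZMod 2) with hS
  have hmem : ∀ p, halfTurn p ∈ Metric.thickening δ K ↔ p ∈ Metric.thickening δ (halfTurn '' K) := by
    intro p
    simp only [Metric.mem_thickening_iff, exists_mem_image]
    refine exists_congr fun k => and_congr_right fun _ => ?_
    rw [← dist_halfTurn p, halfTurn_halfTurn]
  have hmem' : ∀ p, halfTurn p ∈ Metric.thickening δ (halfTurn '' K) ↔ p ∈ Metric.thickening δ K := by
    intro p
    rw [← hmem, halfTurn_halfTurn]
  have hSadd : ∀ x y, S (x, y + 1) = S (x, y) + 1 := by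
    intro x y
    simp only [hS, planeCover_add_one, hmem, hmem']
    by_cases ha : planeCover (x, y) ∈ Metric.thickening δ K
    · have hb := Set.disjoint_left.1 hthick ha
      simp [ha, hb]
    · by_cases hb : planeCover (x, y) ∈ Metric.thickening δ (halfTurn '' K)
      · simp [ha, hb, CharTwo.add_self_eq_zero]
      · simp [ha, hb]
  have hSK : ∀ r, planeCover r ∈ K → ∀ p, dist p r < δ → S p = 0 := by
    intro r hr p hp
    have : planeCover p ∈ Metric.thickening δ K :=
      Metric.mem_thickening_iff.2 ⟨_, hr, (dist_planeCover_le p r).trans_lt hp⟩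
    simp [hS, this]
  have hSK' : ∀ r, halfTurn (planeCover r) ∈ K → ∀ p, dist p r < δ → S p = 1 := by
    intro r hr p hp
    have h2 : planeCover p ∈ Metric.thickening δ (halfTurn '' K) :=
      Metric.mem_thickening_iff.2 ⟨planeCover r, ⟨_, hr, halfTurn_halfTurn _⟩,
        (dist_planeCover_le p r).trans_lt hp⟩
    simp [hS, h2, Set.disjoint_right.1 hthick h2]
  obtain ⟨N, hN⟩ := exists_nat_gt (1 / δ)
  have hN0 : (0 : ℝ) < N := lt_trans (by positivity) hN
  have hNδ : 1 / (N : ℝ) < δ := by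
    rw [div_lt_iff₀ hδ] at hN
    rw [div_lt_iff₀ hN0]
    linarith
  set P : ℕ → ℕ → ℝ × ℝ := fun i j => ((i : ℝ) / N, (j : ℝ) / N) with hP
  have hP1 : ∀ i ≤ N, ∀ j, (P i j).1 ∈ Icc (0:ℝ) 1 := fun i hi j =>
    ⟨by positivity, (div_le_one hN0).2 (by exact_mod_cast hi)⟩
  have hPN : ∀ i, P i N = ((P i 0).1, (P i 0).2 + 1) := by
    intro i
    simp [hP, hN0.ne']
  refine grid_obstruction N (fun i j => P i j ∈ B) (fun i j => S (P i j)) ?_ ?_ ?_ ?_ ?_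
  · intro i _
    simp only [hPN, hB]
  · intro i _
    simp only [hPN, hSadd]
  · intro i hi j hj
    by_cases hsame : ∀ p q, p ∈ ({P i j, P i (j+1), P (i+1) j, P (i+1) (j+1)} : Set (ℝ × ℝ)) →
        q ∈ ({P i j, P i (j+1), P (i+1) j, P (i+1) (j+1)} : Set (ℝ × ℝ)) → p ∈ B → q ∈ B
    · by_cases hb : P i j ∈ B
      · exact Or.inl ⟨hb, hsame _ _ (by simp) (by simp) hb, hsame _ _ (by simp) (by simp) hb,
          hsame _ _ (by simp) (by simp) hb⟩
      · exact Or.inr (Or.inl ⟨hb, fun h => hb (hsame _ _ (by simp) (by simp) h),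
          fun h => hb (hsame _ _ (by simp) (by simp) h),
          fun h => hb (hsame _ _ (by simp) (by simp) h)⟩)
    · push Not at hsame
      obtain ⟨p, q, hp, hq, hpB, hqB⟩ := hsame
      set c : Set (ℝ × ℝ) := Icc ((i : ℝ) / N) ((i + 1 : ℝ) / N) ×ˢ Icc ((j : ℝ) / N) ((j + 1 : ℝ) / N)
        with hc
      have hle : ∀ a : ℝ, a / N ≤ (a + 1) / N := fun a => by gcongr; linarith
      have hcorner : ∀ p ∈ ({P i j, P i (j+1), P (i+1) j, P (i+1) (j+1)} : Set (ℝ × ℝ)), p ∈ c := by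
        intro p hp
        simp only [mem_insert_iff, mem_singleton_iff] at hp
        rcases hp with rfl | rfl | rfl | rfl <;> simp [hP, hc, hle]
      have hconv : Convex ℝ c := (convex_Icc _ _).prod (convex_Icc _ _)
      have hdiam : ∀ p ∈ c, ∀ q ∈ c, dist p q < δ := by
        rintro ⟨p1, p2⟩ ⟨⟨h1, h2⟩, h3, h4⟩ ⟨q1, q2⟩ ⟨⟨h5, h6⟩, h7, h8⟩
        simp only [add_div] at *
        rw [Prod.dist_eq, Real.dist_eq, Real.dist_eq]
        refine max_lt (abs_lt.2 ⟨?_, ?_⟩) (abs_lt.2 ⟨?_, ?_⟩) <;> simp only <;> linarith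
      have hstrip : ∀ p ∈ c, p.1 ∈ Icc (0:ℝ) 1 := by
        rintro p ⟨⟨h1, h2⟩, -⟩
        refine ⟨le_trans (by positivity) h1, h2.trans ?_⟩
        rw [div_le_one hN0]
        exact_mod_cast hi
      obtain ⟨r, hr, hrK⟩ := hsep p q (hstrip p (hcorner p hp)) (hstrip q (hcorner q hq)) hpB hqB
      have hrc := hconv.segment_subset (hcorner p hp) (hcorner q hq) hr
      refine Or.inr (Or.inr ?_)
      have key : ∃ z, ∀ p ∈ ({P i j, P i (j+1), P (i+1) j, P (i+1) (j+1)} : Set (ℝ × ℝ)), S p = z := by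
        rcases hrK with hrK | hrK
        · exact ⟨0, fun p hp => hSK r hrK p (hdiam p (hcorner p hp) r hrc)⟩
        · exact ⟨1, fun p hp => hSK' r hrK p (hdiam p (hcorner p hp) r hrc)⟩
      obtain ⟨z, hz⟩ := key
      rw [hz (P i j) (by simp), hz (P i (j + 1)) (by simp), hz (P (i + 1) j) (by simp),
        hz (P (i + 1) (j + 1)) (by simp)]
      simp
  · intro j _
    simpa [hP] using h0 ((j : ℝ) / N)
  · intro j _
    simpa [hP, hN0.ne'] using h1 ((j : ℝ) / N)

/-- A continuous function on an interval with integer values is constant. -/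
lemma eq_of_continuousOn_of_int {f : ℝ → ℝ} {a b : ℝ} (hab : a ≤ b) (hf : ContinuousOn f (Icc a b))
    (h : ∀ t ∈ Icc a b, ∃ n : ℤ, f t = n) : f a = f b := by
  by_contra hne
  obtain ⟨n, hn⟩ := h a (left_mem_Icc.2 hab)
  obtain ⟨m, hm⟩ := h b (right_mem_Icc.2 hab)
  have hnm : n ≠ m := fun e => hne (by rw [hn, hm, e])
  rw [← uIcc_of_le hab] at hf
  have hsub := intermediate_value_uIcc hf
  rw [hn, hm] at hsub
  have half : ∀ l j : ℤ, (l : ℝ) + 1 / 2 ≠ j := by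
    intro l j hlj
    have h2 : ((2 * l + 1 : ℤ) : ℝ) = ((2 * j : ℤ) : ℝ) := by push_cast; linarith
    have h3 : 2 * l + 1 = 2 * j := by exact_mod_cast h2
    omega
  have hex : ∃ l : ℤ, (l : ℝ) + 1 / 2 ∈ uIcc (n : ℝ) m := by
    rcases lt_or_gt_of_ne hnm with hlt | hlt
    · have : (n : ℝ) + 1 ≤ m := by exact_mod_cast hlt
      exact ⟨n, mem_uIcc.2 (Or.inl ⟨by linarith, by linarith⟩)⟩
    · have : (m : ℝ) + 1 ≤ n := by exact_mod_cast hlt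
      exact ⟨m, mem_uIcc.2 (Or.inr ⟨by linarith, by linarith⟩)⟩
  obtain ⟨l, hl⟩ := hex
  obtain ⟨t, ht, hft⟩ := hsub hl
  rw [uIcc_of_le hab] at ht
  obtain ⟨j, hj⟩ := h t ht
  exact half l j (by rw [← hft, hj])

/-- The function `f` has a continuous logarithm on `[0, 1]` with total increment `k`. -/
def HasLogIncrement (f : ℝ → ℂ) (k : ℂ) : Prop :=
  ∃ L : ℝ → ℂ, ContinuousOn L (Icc 0 1) ∧ (∀ t ∈ Icc (0:ℝ) 1, Complex.exp (L t) = f t) ∧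
    L 1 - L 0 = k

lemma hasLogIncrement_iff_of_near {f g : ℝ → ℂ} {k : ℂ} (hf : Continuous f) (hg : Continuous g)
    (hf1 : f 0 = f 1) (hg1 : g 0 = g 1) (h : ∀ t ∈ Icc (0:ℝ) 1, ‖g t - f t‖ < ‖f t‖) :
    HasLogIncrement f k ↔ HasLogIncrement g k := by
  have hf0 : ∀ t ∈ Icc (0:ℝ) 1, f t ≠ 0 := fun t ht h0 => by
    have := h t ht
    rw [h0, norm_zero] at this
    exact absurd this (norm_nonneg _).not_gt
  have hslit : ∀ t ∈ Icc (0:ℝ) 1, g t / f t ∈ Complex.slitPlane := by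
    intro t ht
    left
    have h1 : ‖g t / f t - 1‖ < 1 := by
      rw [div_sub_one (hf0 t ht), norm_div, div_lt_one (norm_pos_iff.2 (hf0 t ht))]
      exact h t ht
    have h2 := (abs_lt.1 ((Complex.abs_re_le_norm _).trans_lt h1)).1
    simp only [Complex.sub_re, Complex.one_re] at h2
    linarith
  have hcont : ContinuousOn (fun t => Complex.log (g t / f t)) (Icc 0 1) :=
    (hg.continuousOn.div hf.continuousOn hf0).clog hslit
  constructor
  · rintro ⟨L, hL, hexp, hinc⟩
    refine ⟨fun t => L t + Complex.log (g t / f t), hL.add hcont, fun t ht => ?_, ?_⟩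
    · rw [Complex.exp_add, hexp t ht, Complex.exp_log (Complex.slitPlane_ne_zero (hslit t ht)),
        mul_div_cancel₀ _ (hf0 t ht)]
    · simp only [← hf1, ← hg1, ← hinc]
      ring
  · rintro ⟨L, hL, hexp, hinc⟩
    refine ⟨fun t => L t - Complex.log (g t / f t), hL.sub hcont, fun t ht => ?_, ?_⟩
    · have hne := Complex.slitPlane_ne_zero (hslit t ht)
      have hg0 : g t ≠ 0 := fun h0 => hne (by rw [h0, zero_div])
      rw [Complex.exp_sub, hexp t ht, Complex.exp_log hne, div_div_cancel₀ hg0]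
    · simp only [← hf1, ← hg1, ← hinc]
      ring

lemma IsPreconnected.hasLogIncrement_iff {X : Type*} [TopologicalSpace X] {S : Set X}
    (hS : IsPreconnected S) {F : X → ℝ → ℂ} (hF : Continuous (Function.uncurry F))
    (hloop : ∀ p, F p 0 = F p 1) (h0 : ∀ p ∈ S, ∀ t ∈ Icc (0:ℝ) 1, F p t ≠ 0) {k : ℂ} {p q : X}
    (hp : p ∈ S) (hq : q ∈ S) : HasLogIncrement (F p) k ↔ HasLogIncrement (F q) k := by
  refine hS.induction₂' (fun p q => HasLogIncrement (F p) k ↔ HasLogIncrement (F q) k)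
    (fun p hp => ?_) (fun _ _ _ _ _ _ h1 h2 => h1.trans h2) hp hq
  have hFc : ∀ p, Continuous (F p) := fun p => hF.comp (Continuous.prodMk_right p)
  have hev : ∀ᶠ q in nhds p, ∀ t ∈ Icc (0:ℝ) 1, ‖F q t - F p t‖ < ‖F p t‖ := by
    refine isCompact_Icc.eventually_forall_of_forall_eventually fun t ht => ?_
    have h1 : Continuous fun z : X × ℝ => ‖F z.1 z.2 - F p z.2‖ :=
      (hF.sub ((hFc p).comp continuous_snd)).norm
    have h2 : Continuous fun z : X × ℝ => ‖F p z.2‖ := ((hFc p).comp continuous_snd).norm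
    exact h1.continuousAt.eventually_lt h2.continuousAt (by simpa using h0 p hp t ht)
  filter_upwards [nhdsWithin_le_nhds hev] with q hq
  have := hasLogIncrement_iff_of_near (k := k) (hFc p) (hFc q) (hloop p) (hloop q) hq
  exact ⟨this, this.symm⟩

lemma HasLogIncrement.eq_zero_of_re_neg {f : ℝ → ℂ} {k : ℂ} (hf : Continuous f) (hloop : f 0 = f 1)
    (hre : ∀ t ∈ Icc (0:ℝ) 1, (f t).re < 0) (h : HasLogIncrement f k) : k = 0 := by
  obtain ⟨L, hL, hexp, rfl⟩ := h
  have hslit : ∀ t ∈ Icc (0:ℝ) 1, -f t ∈ Complex.slitPlane := fun t ht =>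
    Or.inl (by simpa using hre t ht)
  have hcont : ContinuousOn (fun t => Complex.log (-f t)) (Icc 0 1) :=
    hf.neg.continuousOn.clog hslit
  have hint : ∀ t ∈ Icc (0:ℝ) 1, ∃ n : ℤ,
      L t = Complex.log (-f t) + Real.pi * Complex.I + n * (2 * Real.pi * Complex.I) := by
    intro t ht
    refine Complex.exp_eq_exp_iff_exists_int.1 ?_
    rw [Complex.exp_add, Complex.exp_pi_mul_I, hexp t ht,
      Complex.exp_log (Complex.slitPlane_ne_zero (hslit t ht))]
    ring
  choose! n hn using hint
  set M : ℝ → ℝ := fun t => (L t - Complex.log (-f t) - Real.pi * Complex.I).im / (2 * Real.pi)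
    with hM
  have hMc : ContinuousOn M (Icc 0 1) :=
    (Complex.continuous_im.comp_continuousOn ((hL.sub hcont).sub continuousOn_const)).div_const _
  have hMn : ∀ t ∈ Icc (0:ℝ) 1, M t = n t := by
    intro t ht
    have : L t - Complex.log (-f t) - Real.pi * Complex.I = ((n t * (2 * Real.pi) : ℝ) : ℂ) * Complex.I := by
      rw [hn t ht]; push_cast; ring
    rw [hM]
    simp only
    rw [this, Complex.im_ofReal_mul, Complex.I_im]
    field_simp
  have hnn : (n 0 : ℝ) = n 1 := by
    rw [← hMn 0 (by simp), ← hMn 1 (by simp)]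
    exact eq_of_continuousOn_of_int zero_le_one hMc fun t ht => ⟨n t, hMn t ht⟩
  have hnn' : n 0 = n 1 := by exact_mod_cast hnn
  rw [hn 1 (by simp), hn 0 (by simp), hloop, hnn', sub_self]

/-- A closed curve of nonzero winding number in the interior of the cylinder separates the two
boundary circles. -/
lemma not_mem_of_isPreconnected_of_winding {c g : ℝ → ℝ} (hc : Continuous c) (hg : Continuous g)
    (hc01 : c 0 = c 1) {k : ℤ} (hk : k ≠ 0) (hgk : g 1 - g 0 = k)
    (hcI : ∀ t ∈ Icc (0:ℝ) 1, c t ∈ Ioo (0:ℝ) 1) {S : Set Cyl} (hS : IsPreconnected S)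
    (hdisj : ∀ t ∈ Icc (0:ℝ) 1, ((c t, (g t : AddCircle (1:ℝ))) : Cyl) ∉ S)
    (h0 : ((0, 0) : Cyl) ∈ S) : ((1, 0) : Cyl) ∉ S := by
  intro h1
  set F : Cyl → ℝ → ℂ := fun p t => (Real.exp (2 * Real.pi * (c t - p.1)) : ℂ) *
    (AddCircle.toCircle ((g t : AddCircle (1:ℝ)) - p.2) : ℂ) - 1 with hF
  have hFc : Continuous (Function.uncurry F) := by
    have h1 : Continuous fun z : Cyl × ℝ => (AddCircle.toCircle ((g z.2 : AddCircle (1:ℝ)) - z.1.2)) :=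
      AddCircle.continuous_toCircle.comp
        (((AddCircle.continuous_mk' _).comp (hg.comp continuous_snd)).sub
          (continuous_snd.comp continuous_fst))
    have h2 : Continuous fun z : Cyl × ℝ => Real.exp (2 * Real.pi * (c z.2 - z.1.1)) := by fun_prop
    exact ((Complex.continuous_ofReal.comp h2).mul (continuous_subtype_val.comp h1)).sub
      continuous_const
  have hgcirc : ((g 1 : ℝ) : AddCircle (1:ℝ)) = (g 0 : ℝ) := by
    rw [← sub_eq_zero, ← AddCircle.coe_sub, hgk, AddCircle.coe_eq_zero_iff]
    exact ⟨k, by simp⟩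
  have hloop : ∀ p, F p 0 = F p 1 := fun p => by simp only [hF, hc01, hgcirc]
  have hne : ∀ p ∈ S, ∀ t ∈ Icc (0:ℝ) 1, F p t ≠ 0 := by
    intro p hp t ht hzero
    have heq := sub_eq_zero.1 hzero
    have hnorm := congrArg norm heq
    rw [norm_mul, Circle.norm_coe, mul_one, norm_one, Complex.norm_real, Real.norm_eq_abs,
      Real.abs_exp, Real.exp_eq_one_iff] at hnorm
    rw [hnorm, Real.exp_zero, Complex.ofReal_one, one_mul] at heq
    have hct : c t = p.1 := by
      rcases mul_eq_zero.1 hnorm with h | h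
      · exact absurd h (by positivity)
      · linarith
    have hci : AddCircle.toCircle ((g t : AddCircle (1:ℝ)) - p.2) =
        AddCircle.toCircle (0 : AddCircle (1:ℝ)) := by
      rw [AddCircle.toCircle_zero]
      exact Circle.ext heq
    have := AddCircle.injective_toCircle one_ne_zero hci
    refine hdisj t ht ?_
    rw [hct, sub_eq_zero.1 this]
    exact hp
  have hbot : HasLogIncrement (F (0, 0)) (2 * Real.pi * k * Complex.I) := by
    set z : ℝ → ℂ := fun t => 2 * Real.pi * (c t + g t * Complex.I) with hz
    have hzc : Continuous z := by fun_prop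
    have hslit : ∀ t ∈ Icc (0:ℝ) 1, 1 - Complex.exp (-z t) ∈ Complex.slitPlane := by
      intro t ht
      left
      have h1 : ‖Complex.exp (-z t)‖ < 1 := by
        rw [Complex.norm_exp, Real.exp_lt_one_iff]
        have h2 := (hcI t ht).1
        have h3 : (-z t).re = -(2 * Real.pi * c t) := by
          simp [hz]
        rw [h3]
        have := Real.pi_pos
        have : 0 < 2 * Real.pi * c t := by positivity
        linarith
      have h2 := (Complex.re_le_norm _).trans_lt h1
      simp only [Complex.sub_re, Complex.one_re]
      linarith
    refine ⟨fun t => z t + Complex.log (1 - Complex.exp (-z t)), ?_, fun t ht => ?_, ?_⟩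
    · exact hzc.continuousOn.add
        (ContinuousOn.clog (continuous_const.sub (Complex.continuous_exp.comp hzc.neg)).continuousOn hslit)
    · have hexp : Complex.exp (z t) = (Real.exp (2 * Real.pi * c t) : ℂ) *
          (AddCircle.toCircle (g t : AddCircle (1:ℝ)) : ℂ) := by
        rw [AddCircle.toCircle_apply_mk, Circle.coe_exp, Complex.ofReal_exp, ← Complex.exp_add]
        congr 1
        simp only [hz]
        push_cast
        ring
      rw [Complex.exp_add, Complex.exp_log (Complex.slitPlane_ne_zero (hslit t ht)), mul_sub,
        ← Complex.exp_add, add_neg_cancel, Complex.exp_zero, mul_one, hexp]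
      simp [hF]
    · have hz1 : z 1 = z 0 + ((k : ℤ) : ℂ) * (2 * Real.pi * Complex.I) := by
        have : (g 1 : ℂ) = g 0 + (k : ℤ) := by
          have h : g 1 = g 0 + (k : ℝ) := by linarith
          rw [h]; push_cast; ring
        simp only [hz, ← hc01, this]
        ring
      have hexp1 : Complex.exp (-z 1) = Complex.exp (-z 0) := by
        rw [Complex.exp_neg, Complex.exp_neg, hz1, Complex.exp_add,
          Complex.exp_int_mul_two_pi_mul_I, mul_one]
      simp only [hexp1]
      rw [hz1]
      ring
  have htop := (hS.hasLogIncrement_iff hFc hloop hne h0 h1).1 hbot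
  have hzero := htop.eq_zero_of_re_neg (hFc.comp (Continuous.prodMk_right _)) (hloop _) ?_
  · have := Real.pi_ne_zero
    simp [hk, this] at hzero
  · intro t ht
    have h1 : ‖(Real.exp (2 * Real.pi * (c t - 1)) : ℂ) *
        (AddCircle.toCircle ((g t : AddCircle (1:ℝ)) - 0) : ℂ)‖ < 1 := by
      rw [norm_mul, Circle.norm_coe, mul_one, Complex.norm_real, Real.norm_eq_abs, Real.abs_exp,
        Real.exp_lt_one_iff]
      have := (hcI t ht).2
      have := Real.pi_pos
      exact mul_neg_of_pos_of_neg (by positivity) (by linarith)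
    have h2 := (Complex.re_le_norm _).trans_lt h1
    change ((Real.exp (2 * Real.pi * (c t - 1)) : ℂ) *
        (AddCircle.toCircle ((g t : AddCircle (1:ℝ)) - 0) : ℂ) - 1).re < 0
    rw [Complex.sub_re, Complex.one_re]
    linarith

namespace CylDrawing

variable {G : OrderedGraph V} (D : CylDrawing G)

lemma continuous_edR (e : G.E) : Continuous (D.edR e) :=
  (D.edCont e).comp continuous_projIcc

lemma edR_zero (e : G.E) : D.edR e 0 = D.pos (G.src e) := by
  rw [edR, projIcc_left]
  exact D.ed0 e

lemma edR_one (e : G.E) : D.edR e 1 = D.pos (G.dst e) := by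
  rw [edR, projIcc_right]
  exact D.ed1 e

lemma continuous_dartMap (d : Dart G) : Continuous (D.dartMap d) := by
  unfold dartMap
  cases d.flip
  · simpa using D.continuous_edR d.e
  · exact (D.continuous_edR d.e).comp (continuous_const.sub continuous_id)

lemma dartMap_zero (d : Dart G) : D.dartMap d 0 = D.pos d.fst := by
  unfold dartMap Dart.fst
  cases d.flip <;> simp [edR_zero, edR_one]

lemma dartMap_one (d : Dart G) : D.dartMap d 1 = D.pos d.snd := by
  unfold dartMap Dart.snd
  cases d.flip <;> simp [edR_zero, edR_one]

lemma dartMap_mem_image (d : Dart G) (t : ℝ) : D.dartMap d t ∈ D.image := by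
  unfold dartMap edR
  refine Or.inl (mem_iUnion.2 ⟨d.e, ?_⟩)
  cases d.flip <;> simp

lemma walkMap_mem_image (w : Walk G) (t : ℝ) : D.walkMap w t ∈ D.image :=
  D.dartMap_mem_image _ _

lemma walkMap_eq_dartMap (w : Walk G) (i : Fin w.n) {t : ℝ} (h0 : (i : ℝ) ≤ t * w.n)
    (h1 : t * w.n ≤ i + 1) : D.walkMap w t = D.dartMap (w.d i) (t * w.n - i) := by
  obtain ⟨i, hi⟩ := i
  simp only at h0 h1 ⊢
  rcases h1.lt_or_eq with h1 | h1
  · have hfl : min ⌊t * (w.n : ℝ)⌋₊ (w.n - 1) = i := by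
      rw [(Nat.floor_eq_iff (le_trans (Nat.cast_nonneg i) h0)).2 ⟨h0, h1⟩]
      omega
    unfold walkMap
    simp only [hfl]
  · have hfl : ⌊t * (w.n : ℝ)⌋₊ = i + 1 := by
      rw [h1]
      exact_mod_cast Nat.floor_natCast (R := ℝ) (i + 1)
    rcases Nat.lt_or_ge (i + 1) w.n with hlt | hge
    · have hmin : min ⌊t * (w.n : ℝ)⌋₊ (w.n - 1) = i + 1 := by omega
      unfold walkMap
      simp only [hmin]
      have hz : t * w.n - ((i + 1 : ℕ) : ℝ) = 0 := by rw [h1]; push_cast; ring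
      have ho : t * w.n - (i : ℝ) = 1 := by rw [h1]; ring
      rw [hz, ho, dartMap_zero, dartMap_one, w.chain i hlt]
    · have hmin : min ⌊t * (w.n : ℝ)⌋₊ (w.n - 1) = i := by omega
      unfold walkMap
      simp only [hmin]

lemma walkMap_div (w : Walk G) {i : ℕ} (hi : i ≤ w.n) :
    D.walkMap w ((i : ℝ) / w.n) = D.pos (w.vtx i) := by
  have hn : (w.n : ℝ) ≠ 0 := by exact_mod_cast w.npos.ne'
  unfold Walk.vtx
  split_ifs with h
  · rw [D.walkMap_eq_dartMap w ⟨i, h⟩, div_mul_cancel₀ _ hn, sub_self, dartMap_zero] <;>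
      rw [div_mul_cancel₀ _ hn]
    simp
  · obtain rfl : i = w.n := by omega
    have hcast : ((w.n - 1 : ℕ) : ℝ) + 1 = w.n := by exact_mod_cast Nat.sub_add_cancel w.npos
    rw [D.walkMap_eq_dartMap w ⟨w.n - 1, Nat.sub_lt w.npos Nat.one_pos⟩, div_mul_cancel₀ _ hn,
      ← dartMap_one]
    · congr 1
      simp only
      linarith
    · rw [div_mul_cancel₀ _ hn]
      simp only
      linarith
    · rw [div_mul_cancel₀ _ hn]
      exact hcast.ge

lemma continuousOn_walkMap (w : Walk G) : ContinuousOn (D.walkMap w) (Icc 0 1) := by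
  have hn : (0 : ℝ) < w.n := by exact_mod_cast w.npos
  have key : ∀ k ≤ w.n, ContinuousOn (D.walkMap w) (Icc 0 ((k : ℝ) / w.n)) := by
    intro k
    induction k with
    | zero => intro _; simp
    | succ k ih =>
      intro hk
      have hle : (k : ℝ) / w.n ≤ ((k + 1 : ℕ) : ℝ) / w.n := by gcongr; simp
      rw [← Icc_union_Icc_eq_Icc (by positivity) hle]
      refine (ih (by omega)).union_of_isClosed ?_ isClosed_Icc isClosed_Icc
      refine ContinuousOn.congr (f := fun t => D.dartMap (w.d ⟨k, hk⟩) (t * w.n - k)) ?_ ?_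
      · exact ((D.continuous_dartMap _).comp (by fun_prop)).continuousOn
      · rintro t ⟨h0, h1⟩
        rw [div_le_iff₀ hn] at h0
        rw [le_div_iff₀ hn] at h1
        exact D.walkMap_eq_dartMap w ⟨k, hk⟩ h0 (by push_cast at h1; exact h1)
  simpa [hn.ne'] using key w.n le_rfl

end CylDrawing

namespace CylDrawing

variable {G : OrderedGraph V} (D : CylDrawing G)

lemma isCompact_image [Finite V] : IsCompact D.image := by
  have := G.finE
  exact (isCompact_iUnion fun e => isCompact_range (D.edCont e)).union (finite_range _).isCompact

/-- The face of a drawing next to the boundary circle at height `c`. -/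
def endFace (c : ℝ) : Set Cyl := connectedComponentIn (cylSet \ D.image) ((c, 0) : Cyl)

variable {D}

lemma exists_collar [Finite V] (hint : ∀ p ∈ D.image, p.1 ∈ Ioo (0:ℝ) 1) {c : ℝ}
    (hc : c = 0 ∨ c = 1) : ∃ ε > 0, IsPreconnected ((Metric.ball c ε ∩ Icc 0 1) ×ˢ univ : Set Cyl) ∧
      ((Metric.ball c ε ∩ Icc 0 1) ×ˢ univ : Set Cyl) ⊆ cylSet \ D.image := by
  have hclosed : IsClosed (Prod.fst '' D.image) := (D.isCompact_image.image continuous_fst).isClosed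
  have hmem : c ∈ (Prod.fst '' D.image)ᶜ := by
    rintro ⟨p, hp, rfl⟩
    have := hint p hp
    rcases hc with h | h <;> simp [h] at this
  obtain ⟨ε, hε, hball⟩ := Metric.isOpen_iff.1 hclosed.isOpen_compl c hmem
  refine ⟨ε, hε, ?_, ?_⟩
  · exact (((convex_ball c ε).inter (convex_Icc 0 1)).isPreconnected).prod isPreconnected_univ
  · rintro p ⟨⟨h1, h2⟩, -⟩
    exact ⟨h2, fun hp => hball h1 ⟨p, hp, rfl⟩⟩

lemma mem_Icc_of_end {c : ℝ} (hc : c = 0 ∨ c = 1) : c ∈ Icc (0:ℝ) 1 := by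
  rcases hc with rfl | rfl <;> simp

lemma mem_endFace [Finite V] (hint : ∀ p ∈ D.image, p.1 ∈ Ioo (0:ℝ) 1) {c : ℝ}
    (hc : c = 0 ∨ c = 1) (y : AddCircle (1:ℝ)) : ((c, y) : Cyl) ∈ D.endFace c := by
  obtain ⟨ε, hε, hpre, hsub⟩ := exists_collar hint hc
  have hmem : ∀ y : AddCircle (1:ℝ), ((c, y) : Cyl) ∈ ((Metric.ball c ε ∩ Icc 0 1) ×ˢ univ : Set Cyl) :=
    fun y => ⟨⟨Metric.mem_ball_self hε, mem_Icc_of_end hc⟩, mem_univ _⟩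
  exact hpre.subset_connectedComponentIn (hmem 0) hsub (hmem y)

lemma IsFace.eq_endFace [Finite V] (hint : ∀ p ∈ D.image, p.1 ∈ Ioo (0:ℝ) 1) {F : Set Cyl}
    (hF : D.IsFace F) {x : Cyl} (hx : x ∈ closure F) (hc : x.1 = 0 ∨ x.1 = 1) :
    F = D.endFace x.1 := by
  obtain ⟨ε, hε, hpre, hsub⟩ := exists_collar hint hc
  obtain ⟨p, hp, rfl⟩ := hF
  obtain ⟨y, hy, hyx⟩ := Metric.mem_closure_iff.1 hx ε hε
  have hyc : y ∈ ((Metric.ball x.1 ε ∩ Icc 0 1) ×ˢ univ : Set Cyl) := by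
    refine ⟨⟨?_, ((connectedComponentIn_subset _ _) hy).1⟩, mem_univ _⟩
    rw [Metric.mem_ball']
    exact (le_max_left _ _).trans_lt hyx
  have hxc : ((x.1, 0) : Cyl) ∈ ((Metric.ball x.1 ε ∩ Icc 0 1) ×ˢ univ : Set Cyl) :=
    ⟨⟨Metric.mem_ball_self hε, mem_Icc_of_end hc⟩, mem_univ _⟩
  rw [connectedComponentIn_eq hy]
  exact connectedComponentIn_eq (hpre.subset_connectedComponentIn hyc hsub hxc)

lemma isOuterFace_endFace [Finite V] (hint : ∀ p ∈ D.image, p.1 ∈ Ioo (0:ℝ) 1) {c : ℝ}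
    (hc : c = 0 ∨ c = 1) : D.IsOuterFace (D.endFace c) := by
  have hmem := mem_endFace hint hc 0
  exact ⟨⟨(c, 0), connectedComponentIn_subset _ _ hmem, rfl⟩, _, subset_closure hmem, hc⟩

lemma ncard_outerFaces_eq_two_iff [Finite V] (hint : ∀ p ∈ D.image, p.1 ∈ Ioo (0:ℝ) 1) :
    {F : Set Cyl | D.IsOuterFace F}.ncard = 2 ↔ D.endFace 0 ≠ D.endFace 1 := by
  have hset : {F : Set Cyl | D.IsOuterFace F} = {D.endFace 0, D.endFace 1} := by
    ext F
    constructor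
    · rintro ⟨hF, x, hx, hc⟩
      have := hF.eq_endFace hint hx hc
      rcases hc with h | h <;> rw [h] at this
      · exact Or.inl this
      · exact Or.inr this
    · rintro (rfl | rfl)
      · exact isOuterFace_endFace hint (Or.inl rfl)
      · exact isOuterFace_endFace hint (Or.inr rfl)
  rw [hset]
  constructor
  · intro h heq
    rw [heq, pair_eq_singleton, ncard_singleton] at h
    omega
  · exact ncard_pair

lemma endFace_ne_of_essential [Finite V] (hint : ∀ p ∈ D.image, p.1 ∈ Ioo (0:ℝ) 1) {C : Walk G}
    (hC : C.IsClosed) (hess : D.EssentialIn C) : D.endFace 0 ≠ D.endFace 1 := by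
  intro heq
  obtain ⟨g, hg, hlift, k, hk, hgk⟩ := hess
  have hk0 : k ≠ 0 := by rintro rfl; simp at hk
  have hn : (C.n : ℝ) ≠ 0 := by exact_mod_cast C.npos.ne'
  have hloop : D.walkMap C 0 = D.walkMap C 1 := by
    have h0 := D.walkMap_div C (Nat.zero_le _)
    have h1 := D.walkMap_div C le_rfl
    rw [Nat.cast_zero, zero_div] at h0
    rw [div_self hn] at h1
    rw [h0, h1]
    exact congrArg D.pos hC.symm
  have h01 : (0:ℝ) ≤ 1 := zero_le_one
  refine not_mem_of_isPreconnected_of_winding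
    (c := IccExtend h01 (domRestrict (Icc 0 1) fun t => (D.walkMap C t).1))
    (g := IccExtend h01 (domRestrict (Icc 0 1) g)) ?_ ?_ ?_ hk0 ?_ ?_
    (S := D.endFace 0) isPreconnected_connectedComponentIn ?_ (mem_endFace hint (Or.inl rfl) 0)
    (heq ▸ mem_endFace hint (Or.inr rfl) 0)
  · exact (continuous_fst.comp_continuousOn (D.continuousOn_walkMap C)).domRestrict.Icc_extend'
  · exact hg.domRestrict.Icc_extend'
  · rw [IccExtend_left, IccExtend_right]
    exact congrArg Prod.fst hloop
  · rw [IccExtend_left, IccExtend_right]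
    exact hgk
  · intro t ht
    rw [IccExtend_of_mem _ _ ht]
    exact hint _ (D.walkMap_mem_image C t)
  · intro t ht hmem
    rw [IccExtend_of_mem _ _ ht, IccExtend_of_mem _ _ ht] at hmem
    change (((D.walkMap C t).1, ((g t : ℝ) : AddCircle (1:ℝ))) : Cyl) ∈ _ at hmem
    rw [hlift t ht] at hmem
    exact (connectedComponentIn_subset _ _ hmem).2 (D.walkMap_mem_image C t)

end CylDrawing

namespace OrderedGraph

variable (G : OrderedGraph V) (a : G.E → ZMod 2)

lemma dart_fst_ne_snd {G : OrderedGraph V} (d : Dart G) : d.fst ≠ d.snd := by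
  unfold Dart.fst Dart.snd
  have := G.src_lt_dst d.e
  cases d.flip
  · simpa using this.ne
  · simpa using this.ne'

/-- The double cover of an ordered graph determined by a parity of its edges. -/
def parityCover : SimpleGraph (V × ZMod 2) where
  Adj p q := ∃ d : Dart G, d.fst = p.1 ∧ d.snd = q.1 ∧ q.2 = p.2 + a d.e
  symm := ⟨by
    rintro p q ⟨⟨e, f⟩, h1, h2, h3⟩
    refine ⟨⟨e, !f⟩, ?_, ?_, ?_⟩
    · rw [← h2]; cases f <;> rfl
    · rw [← h1]; cases f <;> rfl
    · rw [h3, add_assoc, CharTwo.add_self_eq_zero, add_zero]⟩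
  loopless := ⟨by
    rintro p ⟨d, h1, h2, -⟩
    exact dart_fst_ne_snd d (h1.trans h2.symm)⟩

variable {G a}

lemma exists_potential_of_not_reachable [Finite V]
    (h : ∀ v, ¬ (G.parityCover a).Reachable (v, 0) (v, 1)) :
    ∃ φ : V → ZMod 2, ∀ e, φ (G.dst e) = φ (G.src e) + a e := by
  classical
  have hfin : Finite (G.parityCover a).ConnectedComponent :=
    Finite.of_surjective (G.parityCover a).connectedComponentMk Quot.mk_surjective
  obtain ⟨f, hf⟩ := Countable.exists_injective_nat (G.parityCover a).ConnectedComponent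
  set c : V → ZMod 2 → ℕ := fun v x => f ((G.parityCover a).connectedComponentMk (v, x)) with hc
  have hne : ∀ v, c v 0 ≠ c v 1 := fun v heq =>
    h v (SimpleGraph.ConnectedComponent.exact (hf heq))
  have hedge : ∀ e x, c (G.src e) x = c (G.dst e) (x + a e) := by
    intro e x
    refine congrArg f (SimpleGraph.ConnectedComponent.sound (SimpleGraph.Adj.reachable ?_))
    exact ⟨⟨e, false⟩, rfl, rfl, rfl⟩
  refine ⟨fun v => if c v 0 < c v 1 then 0 else 1, fun e => ?_⟩
  have h0 := hedge e 0
  have h1 := hedge e 1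
  have hn := hne (G.dst e)
  have ha : a e = 0 ∨ a e = 1 := by
    generalize a e = z
    revert z
    decide
  have h11 : (1 : ZMod 2) + 1 = 0 := by decide
  rcases ha with ha | ha
  · rw [ha, add_zero] at h0 h1
    simp only [h0, h1, ha, add_zero]
  · rw [ha, zero_add] at h0
    rw [ha, h11] at h1
    simp only [h0, h1, ha]
    rcases lt_or_gt_of_ne hn with hlt | hlt
    · simp [hlt, hlt.not_gt, h11]
    · simp [hlt, hlt.not_gt]

lemma exists_odd_cycle_of_reachable
    (h : ∃ v, (G.parityCover a).Reachable (v, 0) (v, 1)) :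
    ∃ C : Walk G, C.IsCycle ∧ ∃ x : ℕ → ZMod 2,
      (∀ i : Fin C.n, x (i + 1) = x i + a (C.d i).e) ∧ x C.n = x 0 + 1 := by
  classical
  have hex : ∃ n v, ∃ p : (G.parityCover a).Walk (v, 0) (v, 1), p.length = n := by
    obtain ⟨v, ⟨p⟩⟩ := h
    exact ⟨_, v, p, rfl⟩
  obtain ⟨r, p, hp⟩ := Nat.find_spec hex
  have hmin : ∀ v (q : (G.parityCover a).Walk (v, 0) (v, 1)), p.length ≤ q.length := by
    intro v q
    rw [hp]
    exact Nat.find_min' hex ⟨v, q, rfl⟩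
  have hpath : p.IsPath := by
    rw [← SimpleGraph.Walk.bypass_eq_self_of_length_le_length_bypass p (hmin r _)]
    exact p.bypass_isPath
  have hpos : 0 < p.length := by
    rcases Nat.eq_zero_or_pos p.length with h0 | h0
    · have := SimpleGraph.Walk.eq_of_length_eq_zero h0
      simp at this
    · exact h0
  have hseg : ∀ i k, i + k ≤ p.length →
      ∃ q : (G.parityCover a).Walk (p.getVert i) (p.getVert (i + k)), q.length = k := by
    intro i k
    induction k with
    | zero => intro _; exact ⟨.nil, rfl⟩
    | succ k ih =>
      intro hk
      obtain ⟨q, hq⟩ := ih (by omega)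
      refine ⟨q.concat (p.adj_getVert_succ (by omega)), ?_⟩
      rw [SimpleGraph.Walk.length_concat, hq]
  have hwalk : ∀ i k, i + k ≤ p.length → (p.getVert i).1 = (p.getVert (i + k)).1 →
      (p.getVert i).2 ≠ (p.getVert (i + k)).2 → p.length ≤ k := by
    intro i k hk h1 h2
    obtain ⟨q, hq⟩ := hseg i k hk
    generalize p.getVert i = s at *
    generalize p.getVert (i + k) = t at *
    obtain ⟨v, x⟩ := s
    obtain ⟨w, y⟩ := t
    simp only at h1 h2
    subst h1
    have hxy : (x = 0 ∧ y = 1) ∨ (x = 1 ∧ y = 0) := by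
      clear q hq
      revert x y
      decide
    rcases hxy with ⟨rfl, rfl⟩ | ⟨rfl, rfl⟩
    · exact hq ▸ hmin v q
    · have := hmin v q.reverse
      rwa [SimpleGraph.Walk.length_reverse, hq] at this
  have hinj : ∀ i j, i < p.length → j < p.length → (p.getVert i).1 = (p.getVert j).1 → i = j := by
    have hlt : ∀ i j, i < j → j < p.length → (p.getVert i).1 ≠ (p.getVert j).1 := by
      intro i j hij hj heq
      obtain ⟨k, rfl⟩ := Nat.exists_eq_add_of_lt hij
      by_cases h2 : (p.getVert i).2 = (p.getVert (i + k + 1)).2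
      · have := hpath.getVert_injOn (by simp; omega) (by simp; omega) (Prod.ext heq h2)
        omega
      · have := hwalk i (k + 1) hj.le heq h2
        omega
    intro i j hi hj heq
    rcases lt_trichotomy i j with h | h | h
    · exact absurd heq (hlt i j h hj)
    · exact h
    · exact absurd heq.symm (hlt j i h hi)
  have hdart : ∀ i : Fin p.length, ∃ d : Dart G, d.fst = (p.getVert i).1 ∧
      d.snd = (p.getVert (i + 1)).1 ∧ (p.getVert (i + 1)).2 = (p.getVert i).2 + a d.e :=
    fun i => p.adj_getVert_succ i.2
  choose d hd1 hd2 hd3 using hdart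
  set C : Walk G := ⟨p.length, hpos, d, fun i hi => by rw [hd1, hd2]⟩ with hC
  have hvtx : ∀ i ≤ p.length, C.vtx i = (p.getVert i).1 := by
    intro i hi
    unfold Walk.vtx
    split_ifs with h
    · exact hd1 _
    · have hi' : p.length - 1 + 1 = i := by
        have : ¬ i < p.length := h
        omega
      exact (hd2 _).trans (by rw [hi'])
  have hx : (p.getVert p.length).2 = (p.getVert 0).2 + 1 := by simp
  have hends : (p.getVert p.length).1 = (p.getVert 0).1 := by simp
  refine ⟨C, ⟨?_, ?_, ?_, ?_⟩, fun i => (p.getVert i).2, hd3, hx⟩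
  · change C.vtx p.length = C.vtx 0
    rw [hvtx _ le_rfl, hvtx 0 (Nat.zero_le _), hends]
  · change 2 ≤ p.length
    by_contra hlt
    have h1 : p.length = 1 := by omega
    apply dart_fst_ne_snd (d ⟨0, hpos⟩)
    rw [hd1, hd2]
    rw [h1] at hends
    exact hends.symm
  · have hlt : ∀ i j : Fin p.length, i < j → (d i).e ≠ (d j).e := by
      intro i j hij heq
      have hij' : (i : ℕ) < j := hij
      have hj := j.2
      by_cases hf : (d i).flip = (d j).flip
      · have : (d i).fst = (d j).fst := by rw [Dart.fst, Dart.fst, heq, hf]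
        rw [hd1, hd1] at this
        have := hinj i j (by omega) j.2 this
        omega
      · have hf' : (d j).flip = !(d i).flip := by
          revert hf
          cases (d i).flip <;> cases (d j).flip <;> simp
        have h1 : (d i).fst = (d j).snd := by
          rw [Dart.fst, Dart.snd, heq, hf']; cases (d i).flip <;> rfl
        have h2 : (d i).snd = (d j).fst := by
          rw [Dart.fst, Dart.snd, heq, hf']; cases (d i).flip <;> rfl
        rw [hd1, hd2] at h1
        rw [hd1, hd2] at h2
        have hij1 := hinj (i + 1) j (by omega) j.2 h2
        rcases Nat.lt_or_ge (j + 1) p.length with hjn | hjn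
        · have := hinj i (j + 1) (by omega) hjn h1
          omega
        · have hjn' : (j : ℕ) + 1 = p.length := by omega
          rw [hjn', hends] at h1
          have hi0 := hinj i 0 (by omega) hpos h1
          have e1 := hd3 i
          have e2 := hd3 j
          rw [hjn', hx, ← hij1, e1, heq, add_assoc, CharTwo.add_self_eq_zero, add_zero, hi0] at e2
          simp at e2
    intro i j heq
    rcases lt_trichotomy i j with h | h | h
    · exact absurd heq (hlt i j h)
    · exact h
    · exact absurd heq.symm (hlt j i h)
  · intro i hi j hj heq
    have hi' : i < p.length := hi
    have hj' : j < p.length := hj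
    rw [hvtx i hi'.le, hvtx j hj'.le] at heq
    exact hinj i j hi' hj' heq

end OrderedGraph

lemma exists_int_eq_add_of_coe_eq {x y : ℝ} (h : (x : AddCircle (1:ℝ)) = y) :
    ∃ n : ℤ, x - y = n := by
  have h0 : ((x - y : ℝ) : AddCircle (1:ℝ)) = 0 := by rw [AddCircle.coe_sub, h, sub_self]
  obtain ⟨n, hn⟩ := (AddCircle.coe_eq_zero_iff (1:ℝ)).1 h0
  exact ⟨n, by simpa using hn.symm⟩

lemma exists_continuous_angle_lift {f : ℝ → AddCircle (1:ℝ)} (hf : ContinuousOn f (Icc 0 1)) :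
    ∃ g : ℝ → ℝ, Continuous g ∧ ∀ t ∈ Icc (0:ℝ) 1, ((g t : ℝ) : AddCircle (1:ℝ)) = f t := by
  obtain ⟨y, hy⟩ := QuotientAddGroup.mk_surjective (f 0)
  obtain ⟨Γ, hΓ, -⟩ := (AddCircle.isCoveringMap_coe (1:ℝ)).exists_path_lifts
    ⟨domRestrict (Icc 0 1) f, hf.domRestrict⟩ y hy.symm
  refine ⟨IccExtend zero_le_one Γ, Γ.continuous.Icc_extend', fun t ht => ?_⟩
  rw [IccExtend_of_mem _ _ ht]
  exact congrFun hΓ ⟨t, ht⟩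

namespace Walk

variable {G : OrderedGraph V} (w : Walk G)

lemma vtx_fin (i : Fin w.n) : w.vtx i = (w.d i).fst := by
  rw [vtx, dif_pos i.2]

lemma vtx_fin_succ (i : Fin w.n) : w.vtx (i + 1) = (w.d i).snd := by
  obtain ⟨i, hi⟩ := i
  unfold vtx
  split_ifs with h
  · exact (w.chain i h).symm
  · simp only at h
    congr 2
    ext
    simp only
    omega

end Walk

namespace CylDrawing

variable {G : OrderedGraph V} (D : CylDrawing G)

/-- A choice of angular coordinates in `ℝ` for the vertices and, continuously and compatibly with
the source, for the edges of a drawing; `shift e` is the resulting discrepancy at the target. -/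
structure AngleLift where
  vert : V → ℝ
  coe_vert : ∀ v, ((vert v : ℝ) : AddCircle (1:ℝ)) = (D.pos v).2
  edge : G.E → ℝ → ℝ
  continuous_edge : ∀ e, Continuous (edge e)
  coe_edge : ∀ e, ∀ t ∈ Icc (0:ℝ) 1, ((edge e t : ℝ) : AddCircle (1:ℝ)) = (D.edR e t).2
  edge_zero : ∀ e, edge e 0 = vert (G.src e)
  shift : G.E → ℤ
  edge_one : ∀ e, edge e 1 = vert (G.dst e) + shift e

lemma nonempty_angleLift : Nonempty D.AngleLift := by
  have hr : ∀ v, ∃ r : ℝ, ((r : ℝ) : AddCircle (1:ℝ)) = (D.pos v).2 :=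
    fun v => QuotientAddGroup.mk_surjective _
  choose r hr using hr
  have hg : ∀ e, ∃ g : ℝ → ℝ, Continuous g ∧
      (∀ t ∈ Icc (0:ℝ) 1, ((g t : ℝ) : AddCircle (1:ℝ)) = (D.edR e t).2) ∧
      g 0 = r (G.src e) ∧ ∃ m : ℤ, g 1 = r (G.dst e) + m := by
    intro e
    obtain ⟨g, hg, hlift⟩ := exists_continuous_angle_lift
      (continuous_snd.comp (D.continuous_edR e)).continuousOn
    obtain ⟨k, hk⟩ := exists_int_eq_add_of_coe_eq (x := g 0) (y := r (G.src e))
      (by rw [hlift 0 (by simp), hr, ← edR_zero]; rfl)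
    have hcoe : ∀ t, ((g t - k : ℝ) : AddCircle (1:ℝ)) = g t := by
      intro t
      rw [AddCircle.coe_sub, sub_eq_self, AddCircle.coe_eq_zero_iff]
      exact ⟨k, by simp⟩
    obtain ⟨m, hm⟩ := exists_int_eq_add_of_coe_eq (x := g 1 - k) (y := r (G.dst e))
      (by rw [hcoe, hlift 1 (by simp), hr, ← edR_one]; rfl)
    exact ⟨fun t => g t - k, hg.sub continuous_const, fun t ht => (hcoe t).trans (hlift t ht),
      by linarith, m, by linarith⟩
  choose g hg1 hg2 hg3 m hm using hg
  exact ⟨⟨r, hr, g, hg1, hg2, hg3, m, hm⟩⟩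

variable {D}

lemma AngleLift.exists_dart_lift (a : D.AngleLift) (d : Dart G) :
    ∃ γ : ℝ → ℝ, Continuous γ ∧
      (∀ t ∈ Icc (0:ℝ) 1, ((γ t : ℝ) : AddCircle (1:ℝ)) = (D.dartMap d t).2) ∧
      ∃ m : ℤ, γ 1 - γ 0 = a.vert d.snd - a.vert d.fst + m ∧ (m : ZMod 2) = a.shift d.e := by
  obtain ⟨e, f⟩ := d
  cases f
  · refine ⟨a.edge e, a.continuous_edge e, a.coe_edge e, a.shift e, ?_, rfl⟩
    rw [a.edge_zero, a.edge_one]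
    simp only [Dart.fst, Dart.snd, Bool.false_eq_true, if_false]
    ring
  · refine ⟨fun t => a.edge e (1 - t), (a.continuous_edge e).comp (by fun_prop),
      fun t ht => a.coe_edge e (1 - t) ⟨by linarith [ht.2], by linarith [ht.1]⟩,
      -a.shift e, ?_, ?_⟩
    · simp only [sub_self, sub_zero, a.edge_zero, a.edge_one, Dart.fst, Dart.snd, if_true]
      push_cast
      ring
    · rw [Int.cast_neg, CharTwo.neg_eq]

lemma AngleLift.essentialIn (a : D.AngleLift) {C : Walk G} (hC : C.IsClosed) {x : ℕ → ZMod 2}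
    (hx : ∀ i : Fin C.n, x (i + 1) = x i + a.shift (C.d i).e) (hn : x C.n = x 0 + 1) :
    D.EssentialIn C := by
  obtain ⟨h, hh, hlift⟩ := exists_continuous_angle_lift
    (continuous_snd.comp_continuousOn (D.continuousOn_walkMap C))
  have hpos : (0:ℝ) < C.n := by exact_mod_cast C.npos
  have key : ∀ i ≤ C.n, ∃ m : ℤ,
      h ((i : ℝ) / C.n) - h 0 = a.vert (C.vtx i) - a.vert (C.vtx 0) + m ∧
        (m : ZMod 2) = x i - x 0 := by
    intro i
    induction i with
    | zero => intro _; exact ⟨0, by simp, by simp⟩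
    | succ i ih =>
      intro hi
      obtain ⟨m, hm, hmx⟩ := ih (by omega)
      obtain ⟨γ, hγ, hγl, k, hk, hkx⟩ := a.exists_dart_lift (C.d ⟨i, hi⟩)
      have hconst := eq_of_continuousOn_of_int (f := fun s => h ((s + i) / C.n) - γ s)
        zero_le_one
        (((hh.comp (by fun_prop : Continuous fun s : ℝ => (s + i) / C.n)).sub hγ).continuousOn)
        (by
          intro s hs
          refine exists_int_eq_add_of_coe_eq ?_
          have hi' : (i : ℝ) + 1 ≤ C.n := by exact_mod_cast hi
          have hmul : (s + i) / C.n * C.n = s + i := div_mul_cancel₀ _ hpos.ne'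
          rw [hlift, hγl s hs, Function.comp, D.walkMap_eq_dartMap C ⟨i, hi⟩]
          · rw [hmul]; simp
          · rw [hmul]; simpa using hs.1
          · rw [hmul]; simp only; linarith [hs.2]
          · constructor
            · exact div_nonneg (add_nonneg hs.1 (Nat.cast_nonneg i)) hpos.le
            · rw [div_le_one hpos]; linarith [hs.2])
      have e1 := C.vtx_fin ⟨i, hi⟩
      have e2 := C.vtx_fin_succ ⟨i, hi⟩
      simp only at e1 e2
      refine ⟨m + k, ?_, ?_⟩
      · rw [← e1, ← e2] at hk
        simp only [zero_add] at hconst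
        have hcast : ((i + 1 : ℕ) : ℝ) = 1 + i := by push_cast; ring
        rw [hcast]
        push_cast
        linarith
      · have := hx ⟨i, hi⟩
        simp only at this
        push_cast
        rw [hmx, hkx, this]
        ring
  obtain ⟨m, hm, hmx⟩ := key C.n le_rfl
  refine ⟨h, hh.continuousOn, hlift, m, ?_, ?_⟩
  · rw [← ZMod.intCast_eq_one_iff_odd, hmx, hn]
    ring
  · rw [div_self hpos.ne'] at hm
    have : C.vtx C.n = C.vtx 0 := hC
    rw [hm, this]
    ring

end CylDrawing

lemma coe_addCircle_two_eq_of_sub_eq {x y : ℝ} {n : ℤ} (h : x - y = n) (hn : Even n) :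
    (x : AddCircle (2:ℝ)) = y := by
  obtain ⟨m, rfl⟩ := hn
  rw [← sub_eq_zero, ← AddCircle.coe_sub, AddCircle.coe_eq_zero_iff]
  refine ⟨m, ?_⟩
  rw [h, zsmul_eq_mul]
  push_cast
  ring

namespace CylDrawing

variable {G : OrderedGraph V} {D : CylDrawing G}

lemma pos_injective : Function.Injective D.pos := by
  intro u v h
  rcases lt_trichotomy u v with huv | huv | huv
  · exact absurd (congrArg Prod.fst h) (D.posOrd u v huv).ne
  · exact huv
  · exact absurd (congrArg Prod.fst h) (D.posOrd v u huv).ne'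

lemma edR_of_mem (e : G.E) {t : ℝ} (ht : t ∈ Icc (0:ℝ) 1) : D.edR e t = D.ed e ⟨t, ht⟩ := by
  rw [edR, projIcc_of_mem _ ht]

namespace AngleLift

variable (a : D.AngleLift) (φ : V → ZMod 2)

/-- The angular coordinates of the vertices and the edges, shifted by a vertex potential. -/
def Marked (p : Cyl) (s : ℝ) : Prop :=
  (∃ v, p = D.pos v ∧ s = a.vert v + (φ v).val) ∨
    ∃ e, ∃ t ∈ Icc (0:ℝ) 1, p = D.edR e t ∧ s = a.edge e t + (φ (G.src e)).val

variable {a φ}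

lemma Marked.coe_eq {p : Cyl} {s : ℝ} (h : a.Marked φ p s) : ((s : ℝ) : AddCircle (1:ℝ)) = p.2 := by
  have hnat : ∀ n : ℕ, ((n : ℝ) : AddCircle (1:ℝ)) = 0 := fun n =>
    (AddCircle.coe_eq_zero_iff (1:ℝ)).2 ⟨n, by simp⟩
  rcases h with ⟨v, rfl, rfl⟩ | ⟨e, t, ht, rfl, rfl⟩
  · rw [AddCircle.coe_add, hnat, add_zero, a.coe_vert]
  · rw [AddCircle.coe_add, hnat, add_zero, a.coe_edge e t ht]

lemma exists_marked {p : Cyl} (hp : p ∈ D.image) : ∃ s, a.Marked φ p s := by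
  rcases hp with hp | ⟨v, rfl⟩
  · obtain ⟨e, t, rfl⟩ := mem_iUnion.1 hp
    exact ⟨_, Or.inr ⟨e, t, t.2, (edR_of_mem e t.2).symm, rfl⟩⟩
  · exact ⟨_, Or.inl ⟨v, rfl, rfl⟩⟩

lemma Marked.vertex_or_interior (hφ : ∀ e, φ (G.dst e) = φ (G.src e) + a.shift e) {p : Cyl}
    {s : ℝ} (h : a.Marked φ p s) :
    (∃ v, p = D.pos v ∧ (s : AddCircle (2:ℝ)) = ((a.vert v + (φ v).val : ℝ) : AddCircle (2:ℝ))) ∨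
      ∃ e, ∃ t : unitInterval, (0 < (t : ℝ) ∧ (t : ℝ) < 1) ∧ p = D.ed e t ∧
        s = a.edge e t + (φ (G.src e)).val := by
  rcases h with ⟨v, rfl, rfl⟩ | ⟨e, t, ht, rfl, rfl⟩
  · exact Or.inl ⟨v, rfl, rfl⟩
  · rcases ht.1.eq_or_lt with rfl | h0
    · exact Or.inl ⟨G.src e, D.edR_zero e, by rw [a.edge_zero]⟩
    rcases ht.2.eq_or_lt with rfl | h1
    · refine Or.inl ⟨G.dst e, D.edR_one e, ?_⟩
      refine coe_addCircle_two_eq_of_sub_eq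
        (n := a.shift e + (φ (G.src e)).val - (φ (G.dst e)).val) ?_ ?_
      · rw [a.edge_one]
        push_cast
        ring
      · rw [← ZMod.intCast_eq_zero_iff_even]
        push_cast
        rw [ZMod.natCast_zmod_val, ZMod.natCast_zmod_val, hφ e]
        ring
    · exact Or.inr ⟨e, ⟨t, ht⟩, ⟨h0, h1⟩, edR_of_mem e ht, rfl⟩

lemma Marked.coe_eq_coe (hemb : D.IsEmbedding)
    (hφ : ∀ e, φ (G.dst e) = φ (G.src e) + a.shift e) {p : Cyl} {s s' : ℝ}
    (h : a.Marked φ p s) (h' : a.Marked φ p s') :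
    (s : AddCircle (2:ℝ)) = (s' : AddCircle (2:ℝ)) := by
  rcases h.vertex_or_interior hφ with ⟨v, rfl, hs⟩ | ⟨e, t, ht, rfl, rfl⟩ <;>
    rcases h'.vertex_or_interior hφ with ⟨v', hv, hs'⟩ | ⟨e', t', ht', hp, rfl⟩
  · rw [hs, hs', pos_injective hv]
  · exact absurd hp.symm (D.noVertexHit e' v t' ht'.1 ht'.2)
  · exact absurd hv (D.noVertexHit e v' t ht.1 ht.2)
  · by_cases hee : e = e'
    · subst hee
      rw [D.edSimple e hp]
    · have hmem : D.ed e t ∈ D.crossSet e e' := ⟨⟨t, ht, rfl⟩, ⟨t', ht', hp.symm⟩⟩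
      rw [hemb e e' hee] at hmem
      exact hmem.elim

variable (a φ)

/-- One sheet of the preimage of a drawing in the double cover of the cylinder. -/
def sheet : Set (ℝ × AddCircle (2:ℝ)) := {k | ∃ p s, a.Marked φ p s ∧ k = (p.1, (s : AddCircle (2:ℝ)))}

lemma isCompact_sheet [Finite V] : IsCompact (a.sheet φ) := by
  have := G.finE
  have heq : a.sheet φ = (⋃ e, (fun t : ℝ => ((D.edR e t).1,
      ((a.edge e t + (φ (G.src e)).val : ℝ) : AddCircle (2:ℝ)))) '' Icc 0 1) ∪
      range fun v => ((D.pos v).1, ((a.vert v + (φ v).val : ℝ) : AddCircle (2:ℝ))) := by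
    ext k
    constructor
    · rintro ⟨p, s, ⟨v, rfl, rfl⟩ | ⟨e, t, ht, rfl, rfl⟩, rfl⟩
      · exact Or.inr ⟨v, rfl⟩
      · exact Or.inl (mem_iUnion.2 ⟨e, t, ht, rfl⟩)
    · rintro (hk | ⟨v, rfl⟩)
      · obtain ⟨e, t, ht, rfl⟩ := mem_iUnion.1 hk
        exact ⟨_, _, Or.inr ⟨e, t, ht, rfl, rfl⟩, rfl⟩
      · exact ⟨_, _, Or.inl ⟨v, rfl, rfl⟩, rfl⟩
  rw [heq]
  refine (isCompact_iUnion fun e => isCompact_Icc.image ?_).union (finite_range _).isCompact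
  exact (continuous_fst.comp (D.continuous_edR e)).prodMk
    ((AddCircle.continuous_mk' (2:ℝ)).comp ((a.continuous_edge e).add continuous_const))

variable {a φ}

lemma halfTurn_notMem_sheet (hemb : D.IsEmbedding)
    (hφ : ∀ e, φ (G.dst e) = φ (G.src e) + a.shift e) {k : ℝ × AddCircle (2:ℝ)}
    (hk : k ∈ a.sheet φ) : halfTurn k ∉ a.sheet φ := by
  rintro ⟨p', s', h', heq⟩
  obtain ⟨p, s, h, rfl⟩ := hk
  simp only [halfTurn, Prod.mk.injEq] at heq
  obtain ⟨h1, h2⟩ := heq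
  rw [← AddCircle.coe_add, ← sub_eq_zero, ← AddCircle.coe_sub, AddCircle.coe_eq_zero_iff] at h2
  obtain ⟨m, hm⟩ := h2
  rw [zsmul_eq_mul] at hm
  have hp : p = p' := by
    refine Prod.ext h1 ?_
    rw [← h.coe_eq, ← h'.coe_eq, ← sub_eq_zero, ← AddCircle.coe_sub, AddCircle.coe_eq_zero_iff]
    refine ⟨2 * m - 1, ?_⟩
    rw [zsmul_eq_mul]
    push_cast
    linarith
  subst hp
  have hss := h.coe_eq_coe hemb hφ h'
  rw [← sub_eq_zero, ← AddCircle.coe_sub, AddCircle.coe_eq_zero_iff] at hss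
  obtain ⟨n, hn⟩ := hss
  rw [zsmul_eq_mul] at hn
  have : ((m * 2 - n * 2 : ℤ) : ℝ) = (1 : ℤ) := by
    push_cast
    linarith
  have := Int.cast_injective this
  omega

lemma planeCover_mem_sheet_or {r : ℝ × ℝ} (hr : ((r.1, (r.2 : AddCircle (1:ℝ))) : Cyl) ∈ D.image) :
    planeCover r ∈ a.sheet φ ∨ halfTurn (planeCover r) ∈ a.sheet φ := by
  obtain ⟨s, hs⟩ := exists_marked (a := a) (φ := φ) hr
  obtain ⟨n, hn⟩ := exists_int_eq_add_of_coe_eq hs.coe_eq.symm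
  rcases Int.even_or_odd n with he | ho
  · exact Or.inl ⟨_, s, hs, Prod.ext rfl (coe_addCircle_two_eq_of_sub_eq hn he)⟩
  · refine Or.inr ⟨_, s, hs, Prod.ext rfl ?_⟩
    change (r.2 : AddCircle (2:ℝ)) + ((1:ℝ) : AddCircle (2:ℝ)) = _
    rw [← AddCircle.coe_add]
    refine coe_addCircle_two_eq_of_sub_eq (n := n + 1) ?_ ho.add_one
    push_cast
    linarith

lemma endFace_eq_of_potential [Finite V] (hemb : D.IsEmbedding)
    (hint : ∀ p ∈ D.image, p.1 ∈ Ioo (0:ℝ) 1)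
    (hφ : ∀ e, φ (G.dst e) = φ (G.src e) + a.shift e) : D.endFace 0 = D.endFace 1 := by
  by_contra hne
  have hcont : Continuous fun p : ℝ × ℝ => ((p.1, (p.2 : AddCircle (1:ℝ))) : Cyl) :=
    continuous_fst.prodMk ((AddCircle.continuous_mk' (1:ℝ)).comp continuous_snd)
  refine not_separating_of_disjoint_halfTurn (a.sheet φ) (a.isCompact_sheet φ)
    (fun k hk => halfTurn_notMem_sheet hemb hφ hk)
    {p : ℝ × ℝ | ((p.1, (p.2 : AddCircle (1:ℝ))) : Cyl) ∈ D.endFace 0} ?_ ?_ ?_ ?_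
  · intro x y
    simp only [mem_ofPred_eq, AddCircle.coe_add, AddCircle.coe_period, add_zero]
  · intro y
    exact mem_endFace hint (Or.inl rfl) _
  · intro y hy
    exact hne ((connectedComponentIn_eq hy).trans
      (connectedComponentIn_eq (mem_endFace hint (Or.inr rfl) _)).symm)
  · intro p q hp hq hpB hqB
    by_contra hno
    push Not at hno
    refine hqB ?_
    have hpre : IsPreconnected ((fun p : ℝ × ℝ => ((p.1, (p.2 : AddCircle (1:ℝ))) : Cyl)) ''
        segment ℝ p q) :=
      (convex_segment p q).isPreconnected.image _ hcont.continuousOn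
    have hsub : (fun p : ℝ × ℝ => ((p.1, (p.2 : AddCircle (1:ℝ))) : Cyl)) '' segment ℝ p q ⊆
        cylSet \ D.image := by
      rintro _ ⟨r, hr, rfl⟩
      refine ⟨?_, fun hmem => ?_⟩
      · exact ((convex_Icc (0:ℝ) 1).is_linear_preimage
          (LinearMap.fst ℝ ℝ ℝ).isLinear).segment_subset hp hq hr
      · rcases planeCover_mem_sheet_or (a := a) (φ := φ) hmem with h | h
        · exact (hno r hr).1 h
        · exact (hno r hr).2 h
    change _ ∈ D.endFace 0
    rw [endFace, connectedComponentIn_eq hpB]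
    exact hpre.subset_connectedComponentIn ⟨p, left_mem_segment ℝ p q, rfl⟩ hsub
      ⟨q, right_mem_segment ℝ p q, rfl⟩

end AngleLift

lemma exists_essential_cycle_of_endFace_ne [Finite V] (hemb : D.IsEmbedding)
    (hint : ∀ p ∈ D.image, p.1 ∈ Ioo (0:ℝ) 1) (hne : D.endFace 0 ≠ D.endFace 1) :
    ∃ C : Walk G, C.IsCycle ∧ D.EssentialIn C := by
  obtain ⟨a⟩ := D.nonempty_angleLift
  by_cases h : ∃ v, (G.parityCover fun e => (a.shift e : ZMod 2)).Reachable (v, 0) (v, 1)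
  · obtain ⟨C, hC, x, hx, hn⟩ := OrderedGraph.exists_odd_cycle_of_reachable h
    exact ⟨C, hC, a.essentialIn hC.1 hx hn⟩
  · push Not at h
    obtain ⟨φ, hφ⟩ := OrderedGraph.exists_potential_of_not_reachable h
    exact absurd (AngleLift.endFace_eq_of_potential hemb hint hφ) hne

end CylDrawing

/-- in a radial embedding (drawn in the interior of the
cylinder) of an ordered graph, there are exactly two outer faces if and only
if the graph contains an essential cycle. -/
theorem two_outer_faces_iff_essential_cycle {V : Type} [LinearOrder V] [Finite V]
    (G : OrderedGraph V) (D : CylDrawing G) (hrad : D.IsRadial)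
    (hemb : D.IsEmbedding) (hint : ∀ p ∈ D.image, p.1 ∈ Ioo (0:ℝ) 1) :
    {F : Set Cyl | D.IsOuterFace F}.ncard = 2 ↔
      ∃ C : Walk G, C.IsCycle ∧ D.EssentialIn C := by
  refine (CylDrawing.ncard_outerFaces_eq_two_iff hint).trans
    ⟨CylDrawing.exists_essential_cycle_of_endFace_ne hemb hint, ?_⟩
  rintro ⟨C, hC, hess⟩
  exact CylDrawing.endFace_ne_of_essential hint hC.1 hess
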